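/- Let m > 0 be the particle mass and β > 0 the inverse temperature. Suppose the differential cross-section σ satisfies: there exist α with 3 < α < 4, c > -2 and B' > 0 such that σ(g, Θ) ≤ B' · g^(−α) · (sin Θ)^c for all g > 0 and Θ ∈ (0, π). Then there exists a constant ν₀ > 0 such that the collision frequency satisfies ν(p) ≤ ν₀ · (E(p)/m)^(−(α−2)/2) for all p ∈ ℝ³; in particular ν is bounded above by ν₀. -/

import Mathlib

open MeasureTheory Real RealInnerProductSpace

/-- Relativistic energy `E(p) = √(‖p‖² + m²)`. -/
noncomputable def energy (m : ℝ) (p : EuclideanSpace ℝ (Fin 3)) : ℝ :=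
  Real.sqrt (‖p‖ ^ 2 + m ^ 2)

/-- Relative momentum `g(p,q) = √(2(E(p)E(q) − ⟨p,q⟩ − m²))`. -/
noncomputable def relMom (m : ℝ) (p q : EuclideanSpace ℝ (Fin 3)) : ℝ :=
  Real.sqrt (2 * (energy m p * energy m q - ⟪p, q⟫ - m ^ 2))

/-- Total cross-section `σ_T(g) = 2π ∫_0^π σ(g,Θ) sin Θ dΘ`. -/
noncomputable def totalXsec (σ : ℝ → ℝ → ℝ) (g : ℝ) : ℝ :=
  2 * Real.pi * ∫ Θ in (0:ℝ)..Real.pi, σ g Θ * Real.sin Θ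

/-- Collision frequency
`ν(p) = E(p)⁻¹ ∫ (e^{−βE(q)}/E(q)) g(p,q) √(g(p,q)² + 4m²) σ_T(g(p,q)) dq`. -/
noncomputable def collFreq (m β : ℝ) (σ : ℝ → ℝ → ℝ) (p : EuclideanSpace ℝ (Fin 3)) : ℝ :=
  (energy m p)⁻¹ * ∫ q : EuclideanSpace ℝ (Fin 3),
    (Real.exp (-β * energy m q) / energy m q) * relMom m p q *
      Real.sqrt ((relMom m p q) ^ 2 + 4 * m ^ 2) * totalXsec σ (relMom m p q)

/-- Angular integral bound. -/
lemma totalXsec_bound (σ : ℝ → ℝ → ℝ) (hσ : ∀ g Θ, 0 ≤ σ g Θ)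
    (α c B' : ℝ) (hc : -2 < c) (hB' : 0 < B')
    (hup : ∀ g Θ : ℝ, 0 < g → Θ ∈ Set.Ioo 0 Real.pi →
      σ g Θ ≤ B' * g ^ (-α) * Real.sin Θ ^ c) :
    ∃ C : ℝ, 0 < C ∧ ∀ g, 0 < g → totalXsec σ g ≤ C * g ^ (-α) := by
  have hπ := Real.pi_pos
  set d := c + 1 with hd
  have hd1 : -1 < d := by linarith
  set b : ℝ → ℝ := fun Θ => 1 + (2 / Real.pi) ^ d * (Θ ^ d + (Real.pi - Θ) ^ d) with hb
  have hint : IntervalIntegrable b volume 0 Real.pi := by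
    have h1 : IntervalIntegrable (fun x : ℝ => x ^ d) volume 0 Real.pi :=
      intervalIntegral.intervalIntegrable_rpow' hd1
    have h2 : IntervalIntegrable (fun x : ℝ => (Real.pi - x) ^ d) volume 0 Real.pi := by
      have := h1.comp_sub_left Real.pi
      simp only [sub_zero, sub_self] at this
      exact this.symm
    exact intervalIntegrable_const.add ((h1.add h2).const_mul _)
  have hpt : ∀ Θ ∈ Set.Ioo 0 Real.pi, Real.sin Θ ^ d ≤ b Θ := by
    rintro Θ ⟨h0, h1⟩
    have hs : 0 < Real.sin Θ := Real.sin_pos_of_pos_of_lt_pi h0 h1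
    have p0 : 0 ≤ (2 / Real.pi) ^ d := by positivity
    have p1 : 0 ≤ Θ ^ d := Real.rpow_nonneg h0.le _
    have p2 : 0 ≤ (Real.pi - Θ) ^ d := Real.rpow_nonneg (by linarith) _
    rcases le_or_gt 0 d with h | h
    · have : Real.sin Θ ^ d ≤ 1 := Real.rpow_le_one hs.le (Real.sin_le_one _) h
      have : 0 ≤ (2 / Real.pi) ^ d * (Θ ^ d + (Real.pi - Θ) ^ d) := by positivity
      simp only [hb]; linarith
    · rcases le_total Θ (Real.pi / 2) with h2 | h2
      · have h3 := Real.mul_le_sin h0.le h2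
        have h4 := Real.rpow_le_rpow_of_nonpos (by positivity) h3 h.le
        rw [Real.mul_rpow (by positivity) h0.le] at h4
        have := mul_nonneg p0 p2
        simp only [hb]; linarith
      · have h3 := Real.mul_le_sin (x := Real.pi - Θ) (by linarith) (by linarith)
        rw [Real.sin_pi_sub] at h3
        have h5 : 0 < Real.pi - Θ := by linarith
        have h4 := Real.rpow_le_rpow_of_nonpos (by positivity) h3 h.le
        rw [Real.mul_rpow (by positivity) h5.le] at h4
        have := mul_nonneg p0 p1
        simp only [hb]; linarith
  have hI0 : 0 ≤ ∫ Θ in (0:ℝ)..Real.pi, b Θ := by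
    apply intervalIntegral.integral_nonneg hπ.le
    rintro Θ ⟨h0, h1⟩
    have p1 : 0 ≤ Θ ^ d := Real.rpow_nonneg h0 _
    have p2 : 0 ≤ (Real.pi - Θ) ^ d := Real.rpow_nonneg (by linarith) _
    simp only [hb]; positivity
  refine ⟨2 * Real.pi * (B' * ((∫ Θ in (0:ℝ)..Real.pi, b Θ) + 1)), by positivity, ?_⟩
  intro g hg
  have hgα : 0 < g ^ (-α) := Real.rpow_pos_of_pos hg _
  have key : ∫ Θ in (0:ℝ)..Real.pi, σ g Θ * Real.sin Θ
      ≤ ∫ Θ in (0:ℝ)..Real.pi, (B' * g ^ (-α)) * b Θ := by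
    rw [intervalIntegral.integral_of_le hπ.le, intervalIntegral.integral_of_le hπ.le,
      integral_Ioc_eq_integral_Ioo, integral_Ioc_eq_integral_Ioo]
    apply integral_mono_of_nonneg
    · filter_upwards [ae_restrict_mem measurableSet_Ioo] with Θ hΘ
      exact mul_nonneg (hσ _ _) (Real.sin_pos_of_pos_of_lt_pi hΘ.1 hΘ.2).le
    · have := ((hint.const_mul (B' * g ^ (-α)))).1
      exact this.mono_set Set.Ioo_subset_Ioc_self
    · filter_upwards [ae_restrict_mem measurableSet_Ioo] with Θ hΘ
      have hs : 0 < Real.sin Θ := Real.sin_pos_of_pos_of_lt_pi hΘ.1 hΘ.2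
      calc σ g Θ * Real.sin Θ ≤ (B' * g ^ (-α) * Real.sin Θ ^ c) * Real.sin Θ :=
            mul_le_mul_of_nonneg_right (hup g Θ hg hΘ) hs.le
        _ = (B' * g ^ (-α)) * Real.sin Θ ^ d := by
            rw [hd, Real.rpow_add_one hs.ne']; ring
        _ ≤ _ := mul_le_mul_of_nonneg_left (hpt Θ hΘ) (by positivity)
  rw [intervalIntegral.integral_const_mul] at key
  unfold totalXsec
  calc 2 * Real.pi * ∫ Θ in (0:ℝ)..Real.pi, σ g Θ * Real.sin Θ
      ≤ 2 * Real.pi * (B' * g ^ (-α) * ∫ Θ in (0:ℝ)..Real.pi, b Θ) := by gcongr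
    _ ≤ 2 * Real.pi * (B' * g ^ (-α) * ((∫ Θ in (0:ℝ)..Real.pi, b Θ) + 1)) := by
        gcongr; linarith
    _ = _ := by ring

lemma totalXsec_nonneg (σ : ℝ → ℝ → ℝ) (hσ : ∀ g Θ, 0 ≤ σ g Θ) (g : ℝ) :
    0 ≤ totalXsec σ g := by
  unfold totalXsec
  have hπ := Real.pi_pos
  refine mul_nonneg (by positivity) (intervalIntegral.integral_nonneg hπ.le ?_)
  intro Θ hΘ
  exact mul_nonneg (hσ _ _) (Real.sin_nonneg_of_mem_Icc hΘ)

lemma energy_ge (m : ℝ) (hm : 0 < m) (p : EuclideanSpace ℝ (Fin 3)) : m ≤ energy m p :=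
  Real.le_sqrt_of_sq_le (by nlinarith [sq_nonneg ‖p‖])

lemma norm_le_energy (m : ℝ) (p : EuclideanSpace ℝ (Fin 3)) : ‖p‖ ≤ energy m p :=
  Real.le_sqrt_of_sq_le (by nlinarith [sq_nonneg m])

lemma energy_sq (m : ℝ) (p : EuclideanSpace ℝ (Fin 3)) :
    energy m p ^ 2 = ‖p‖ ^ 2 + m ^ 2 := Real.sq_sqrt (by positivity)

lemma energy_le_add (m : ℝ) (hm : 0 < m) (p q : EuclideanSpace ℝ (Fin 3)) :
    energy m p ≤ energy m q + ‖q - p‖ := by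
  have h1 := norm_le_energy m q
  have h2 := energy_sq m q
  have h3 : ‖p‖ ≤ ‖q‖ + ‖q - p‖ := by
    have := norm_sub_le q (q - p); simpa using this
  have h4 := energy_ge m hm q
  refine Real.sqrt_le_iff.2 ⟨by linarith [norm_nonneg (q - p)], ?_⟩
  nlinarith [norm_nonneg p, norm_nonneg q, norm_nonneg (q - p),
    mul_le_mul_of_nonneg_right h1 (norm_nonneg (q - p))]

lemma inner_add_le (m : ℝ) (hm : 0 < m) (p q : EuclideanSpace ℝ (Fin 3)) :
    ‖p‖ * ‖q‖ + m ^ 2 ≤ energy m p * energy m q := by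
  have hp := energy_ge m hm p
  have hq := energy_ge m hm q
  refine abs_le_of_sq_le_sq' ?_ (by nlinarith) |>.2
  rw [mul_pow, energy_sq, energy_sq]
  nlinarith [sq_nonneg (‖p‖ - ‖q‖), sq_nonneg m, mul_nonneg (sq_nonneg m) (sq_nonneg (‖p‖ - ‖q‖))]

lemma relMom_facts (m : ℝ) (hm : 0 < m) (p q : EuclideanSpace ℝ (Fin 3)) :
    m ^ 2 * ‖q - p‖ ^ 2 ≤ relMom m p q ^ 2 * (energy m p * energy m q) ∧
    Real.sqrt (relMom m p q ^ 2 + 4 * m ^ 2) ≤ 2 * (energy m p * energy m q) ^ (1 / 2 : ℝ) := by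
  have hp := energy_ge m hm p
  have hq := energy_ge m hm q
  have hin := abs_le.1 (abs_real_inner_le_norm p q)
  have hk := inner_add_le m hm p q
  have hnn : 0 ≤ 2 * (energy m p * energy m q - ⟪p, q⟫ - m ^ 2) := by linarith [hin.2]
  have hsq : relMom m p q ^ 2 = 2 * (energy m p * energy m q - ⟪p, q⟫ - m ^ 2) :=
    Real.sq_sqrt hnn
  have hX : 0 < energy m p * energy m q := mul_pos (by linarith) (by linarith)
  constructor
  · rw [hsq]
    have hr : ‖q - p‖ ^ 2 = ‖p‖ ^ 2 - 2 * ⟪p, q⟫ + ‖q‖ ^ 2 := by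
      rw [norm_sub_sq_real, real_inner_comm]; ring
    have hXX : (energy m p * energy m q) ^ 2 = (‖p‖ ^ 2 + m ^ 2) * (‖q‖ ^ 2 + m ^ 2) := by
      rw [mul_pow, energy_sq, energy_sq]
    have hcs : (⟪p, q⟫ : ℝ) ^ 2 ≤ ‖p‖ ^ 2 * ‖q‖ ^ 2 := by
      rw [← mul_pow]; exact sq_le_sq' hin.1 hin.2
    rw [hr]
    set Z := energy m p * energy m q
    set t : ℝ := ⟪p, q⟫
    have h1 : m ^ 2 * (‖p‖ ^ 2 - 2 * t + ‖q‖ ^ 2) ≤ (Z - t - m ^ 2) * (Z + t + m ^ 2) := by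
      nlinarith
    have h2 : (Z - t - m ^ 2) * (Z + t + m ^ 2) ≤ (Z - t - m ^ 2) * (2 * Z) :=
      mul_le_mul_of_nonneg_left (by linarith [hin.2]) (by linarith)
    linarith
  · rw [← Real.sqrt_eq_rpow]
    refine Real.sqrt_le_iff.2 ⟨by positivity, ?_⟩
    rw [mul_pow, Real.sq_sqrt hX.le, hsq]
    linarith [hin.1]

lemma rpow_le_exp (β a x : ℝ) (hβ : 0 < β) (ha : 0 < a) (hx : 0 < x) :
    x ^ a ≤ (a / β) ^ a * Real.exp (β * x) := by
  have h1 : x ≤ (a / β) * Real.exp (β * x / a) := by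
    have h := Real.add_one_le_exp (β * x / a)
    calc x = (a / β) * (β * x / a) := by field_simp
      _ ≤ _ := by gcongr; linarith
  calc x ^ a ≤ ((a / β) * Real.exp (β * x / a)) ^ a := by gcongr
    _ = _ := by
      rw [Real.mul_rpow (by positivity) (Real.exp_pos _).le, ← Real.exp_mul]
      congr 2; field_simp

/-- The purely real-variable pointwise estimate. -/
lemma pointwise_real (m β α : ℝ) (hm : 0 < m) (hα3 : 3 < α)
    (X Y r g s : ℝ) (hX : m ≤ X) (hY : m ≤ Y) (hr : 0 < r) (hg : 0 ≤ g)
    (hgr : m ^ 2 * r ^ 2 ≤ g ^ 2 * (X * Y)) (hXY : X ≤ Y + r)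
    (hs : s ≤ 2 * (X * Y) ^ (1 / 2 : ℝ)) :
    Real.exp (-β * Y) / Y * g * s * g ^ (-α) ≤
      2 * m ^ (1 - α) * (1 + 1 / m) ^ (α - 2) *
        (X * X ^ (-((α - 2) / 2))) * (Real.exp (-β * Y) * Y ^ (3 * α / 2 - 3)) *
        ((if r < 1 then r ^ (1 - α) else 0) + 1) := by
  have hX0 : 0 < X := by linarith
  have hY0 : 0 < Y := by linarith
  have hZ : 0 < X * Y := by positivity
  have hg0 : 0 < g := by
    rcases hg.lt_or_eq with h | h
    · exact h
    · rw [← h] at hgr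
      have : 0 < m ^ 2 * r ^ 2 := by positivity
      simp at hgr; linarith
  have hgl : m * r * (X * Y) ^ (-(1 / 2) : ℝ) ≤ g := by
    have h1 : m * r ≤ g * (X * Y) ^ (1 / 2 : ℝ) := by
      refine abs_le_of_sq_le_sq' ?_ (by positivity) |>.2
      rw [mul_pow, mul_pow, ← Real.sqrt_eq_rpow, Real.sq_sqrt hZ.le]; exact hgr
    rw [Real.rpow_neg hZ.le, ← div_eq_mul_inv]
    exact (div_le_iff₀ (by positivity)).2 h1
  have hgp : g ^ (1 - α) ≤ m ^ (1 - α) * r ^ (1 - α) * (X * Y) ^ ((α - 1) / 2) := by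
    have h := Real.rpow_le_rpow_of_nonpos (by positivity) hgl (show 1 - α ≤ 0 by linarith)
    rw [Real.mul_rpow (by positivity) (by positivity), Real.mul_rpow hm.le hr.le,
      ← Real.rpow_mul hZ.le] at h
    convert h using 3
    ring
  have hXp : X ^ (α - 2) * r ^ (1 - α) ≤ Y ^ (α - 2) * ((1 + 1 / m) ^ (α - 2) *
      ((if r < 1 then r ^ (1 - α) else 0) + 1)) := by
    have hXY2 : X ≤ Y * (1 + r / m) := by
      have : r ≤ Y * (r / m) := by
        rw [← mul_div_assoc, le_div_iff₀ hm]; nlinarith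
      linarith
    have h1 : X ^ (α - 2) ≤ Y ^ (α - 2) * (1 + r / m) ^ (α - 2) := by
      rw [← Real.mul_rpow hY0.le (by positivity)]
      exact Real.rpow_le_rpow hX0.le hXY2 (by linarith)
    have h2 : (1 + r / m) ^ (α - 2) * r ^ (1 - α) ≤ (1 + 1 / m) ^ (α - 2) *
        ((if r < 1 then r ^ (1 - α) else 0) + 1) := by
      split_ifs with h
      · gcongr
        · linarith
        · linarith
      · push Not at h
        have h3 : 1 + r / m ≤ (1 + 1 / m) * r := by
          have : (1 + 1 / m) * r = r + r / m := by ring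
          linarith
        have h4 : (1 + r / m) ^ (α - 2) ≤ (1 + 1 / m) ^ (α - 2) * r ^ (α - 2) := by
          rw [← Real.mul_rpow (by positivity) hr.le]
          exact Real.rpow_le_rpow (by positivity) h3 (by linarith)
        calc _ ≤ (1 + 1 / m) ^ (α - 2) * r ^ (α - 2) * r ^ (1 - α) := by gcongr
          _ = (1 + 1 / m) ^ (α - 2) * r ^ (-1 : ℝ) := by
            rw [mul_assoc, ← Real.rpow_add hr]; congr 2; ring
          _ ≤ _ := by
            gcongr
            rw [zero_add]
            exact Real.rpow_le_one_of_one_le_of_nonpos h (by norm_num)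
    calc _ ≤ Y ^ (α - 2) * (1 + r / m) ^ (α - 2) * r ^ (1 - α) := by gcongr
      _ = Y ^ (α - 2) * ((1 + r / m) ^ (α - 2) * r ^ (1 - α)) := by ring
      _ ≤ _ := by gcongr
  have e1 : g * g ^ (-α) = g ^ (1 - α) := by
    rw [show 1 - α = -α + 1 by ring, Real.rpow_add_one hg0.ne']; ring
  have e2 : (X * Y) ^ (1 / 2 : ℝ) * (X * Y) ^ ((α - 1) / 2) = X ^ (α / 2) * Y ^ (α / 2) := by
    rw [← Real.rpow_add hZ, ← Real.mul_rpow hX0.le hY0.le]; congr 1; ring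
  have e3 : X ^ (α / 2) = X * X ^ (-((α - 2) / 2)) * X ^ (α - 2) := by
    rw [mul_comm X, ← Real.rpow_add_one hX0.ne', ← Real.rpow_add hX0]; congr 1; ring
  have e4 : Y⁻¹ * Y ^ (α / 2) * Y ^ (α - 2) = Y ^ (3 * α / 2 - 3) := by
    rw [← Real.rpow_neg_one, ← Real.rpow_add hY0, ← Real.rpow_add hY0]; congr 1; ring
  calc Real.exp (-β * Y) / Y * g * s * g ^ (-α)
      = Real.exp (-β * Y) / Y * s * (g * g ^ (-α)) := by ring
    _ = Real.exp (-β * Y) / Y * s * g ^ (1 - α) := by rw [e1]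
    _ ≤ Real.exp (-β * Y) / Y * (2 * (X * Y) ^ (1 / 2 : ℝ)) *
        (m ^ (1 - α) * r ^ (1 - α) * (X * Y) ^ ((α - 1) / 2)) := by gcongr
    _ = Real.exp (-β * Y) * Y⁻¹ * 2 * m ^ (1 - α) * r ^ (1 - α) *
        ((X * Y) ^ (1 / 2 : ℝ) * (X * Y) ^ ((α - 1) / 2)) := by ring
    _ = Real.exp (-β * Y) * Y⁻¹ * 2 * m ^ (1 - α) * (X * X ^ (-((α - 2) / 2))) * Y ^ (α / 2) *
        (X ^ (α - 2) * r ^ (1 - α)) := by rw [e2, e3]; ring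
    _ ≤ Real.exp (-β * Y) * Y⁻¹ * 2 * m ^ (1 - α) * (X * X ^ (-((α - 2) / 2))) * Y ^ (α / 2) *
        (Y ^ (α - 2) * ((1 + 1 / m) ^ (α - 2) *
      ((if r < 1 then r ^ (1 - α) else 0) + 1))) := by gcongr
    _ = _ := by rw [← e4]; ring

lemma integrable_sing (α : ℝ) (hα4 : α < 4) :
    Integrable (fun x : EuclideanSpace ℝ (Fin 3) =>
      if ‖x‖ < 1 then ‖x‖ ^ (1 - α) else 0) := by
  have h := integrable_fun_norm_addHaar (volume : Measure (EuclideanSpace ℝ (Fin 3)))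
    (f := fun y : ℝ => if y < 1 then y ^ (1 - α) else 0)
  refine h.2 ?_
  simp only [finrank_euclideanSpace, Fintype.card_fin, smul_eq_mul]
  have h1 : IntegrableOn (fun y : ℝ => y ^ (3 - α)) (Set.Ioo 0 1) :=
    (intervalIntegral.integrableOn_Ioo_rpow_iff one_pos).2 (by linarith)
  have h2 : IntegrableOn (Set.indicator (Set.Ioo 0 1) (fun y : ℝ => y ^ (3 - α))) (Set.Ioi 0) :=
    ((integrable_indicator_iff measurableSet_Ioo).2 h1).integrableOn
  refine h2.congr_fun ?_ measurableSet_Ioi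
  intro y hy
  have hy : 0 < y := hy
  by_cases hy1 : y < 1
  · have : y ∈ Set.Ioo (0:ℝ) 1 := ⟨hy, hy1⟩
    simp only [Set.indicator_of_mem this, hy1, if_true]
    rw [← Real.rpow_natCast, ← Real.rpow_add hy]; congr 1; norm_num; ring
  · simp [Set.indicator, hy1]

theorem soft_interaction_upper_bound_strong (m β : ℝ) (hm : 0 < m) (hβ : 0 < β)
    (σ : ℝ → ℝ → ℝ) (hσ : ∀ g Θ, 0 ≤ σ g Θ)
    (α c B' : ℝ) (hα3 : 3 < α) (hα4 : α < 4) (hc : -2 < c) (hB' : 0 < B')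
    (hup : ∀ g Θ : ℝ, 0 < g → Θ ∈ Set.Ioo 0 Real.pi →
      σ g Θ ≤ B' * g ^ (-α) * Real.sin Θ ^ c) :
    ∃ ν₀ : ℝ, 0 < ν₀ ∧
      (∀ p : EuclideanSpace ℝ (Fin 3),
        collFreq m β σ p ≤ ν₀ * (energy m p / m) ^ (-((α - 2) / 2))) ∧
      (∀ p : EuclideanSpace ℝ (Fin 3), collFreq m β σ p ≤ ν₀) := by
  obtain ⟨C, hC, hCb⟩ := totalXsec_bound σ hσ α c B' hc hB' hup
  set k := 3 * α / 2 - 3 with hk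
  have hk0 : 0 < k := by rw [hk]; linarith
  -- weight bounds
  set D1 := (k / β) ^ k with hD1
  set D2 := (1 + 1 / m) ^ (4 : ℝ) * ((k + 4) / β) ^ (k + 4) with hD2
  have hD1p : 0 < D1 := by positivity
  have hD2p : 0 < D2 := by positivity
  have hw1 : ∀ Y, m ≤ Y → Real.exp (-β * Y) * Y ^ k ≤ D1 := by
    intro Y hY
    have h := rpow_le_exp β k Y hβ hk0 (by linarith)
    calc _ ≤ Real.exp (-β * Y) * (D1 * Real.exp (β * Y)) := by gcongr
      _ = D1 * (Real.exp (-β * Y) * Real.exp (β * Y)) := by ring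
      _ = D1 := by rw [← Real.exp_add]; simp
  have hw2 : ∀ q : EuclideanSpace ℝ (Fin 3),
      Real.exp (-β * energy m q) * energy m q ^ k ≤ D2 * (1 + ‖q‖) ^ (-4 : ℝ) := by
    intro q
    have hY := energy_ge m hm q
    have hq := norm_le_energy m q
    set Y := energy m q
    have hY0 : 0 < Y := by linarith
    have h := rpow_le_exp β (k + 4) Y hβ (by linarith) hY0
    have h1 : 1 + ‖q‖ ≤ (1 + 1 / m) * Y := by
      have : 1 ≤ 1 / m * Y := by rw [one_div_mul_eq_div, le_div_iff₀ hm]; linarith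
      linarith
    have hp : 0 < 1 + ‖q‖ := by positivity
    rw [Real.rpow_neg hp.le, ← div_eq_mul_inv, le_div_iff₀ (by positivity)]
    calc Real.exp (-β * Y) * Y ^ k * (1 + ‖q‖) ^ (4 : ℝ)
        ≤ Real.exp (-β * Y) * Y ^ k * ((1 + 1 / m) * Y) ^ (4 : ℝ) := by gcongr
      _ = (1 + 1 / m) ^ (4 : ℝ) * Real.exp (-β * Y) * Y ^ (k + 4) := by
          rw [Real.mul_rpow (by positivity) hY0.le, Real.rpow_add hY0]; ring
      _ ≤ (1 + 1 / m) ^ (4 : ℝ) * Real.exp (-β * Y) *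
          (((k + 4) / β) ^ (k + 4) * Real.exp (β * Y)) := by gcongr
      _ = D2 * (Real.exp (-β * Y) * Real.exp (β * Y)) := by rw [hD2]; ring
      _ = D2 := by rw [← Real.exp_add]; simp
  -- integrable majorants
  have hS := integrable_sing α hα4
  set S : EuclideanSpace ℝ (Fin 3) → ℝ := fun x => if ‖x‖ < 1 then ‖x‖ ^ (1 - α) else 0 with hSdef
  have hT : Integrable (fun q : EuclideanSpace ℝ (Fin 3) => (1 + ‖q‖) ^ (-4 : ℝ)) :=
    integrable_one_add_norm (by simp; norm_num)
  have hS0 : ∀ x, 0 ≤ S x := by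
    intro x; simp only [hSdef]; split_ifs <;> positivity
  set J := D1 * (∫ x, S x) + D2 * (∫ q : EuclideanSpace ℝ (Fin 3), (1 + ‖q‖) ^ (-4 : ℝ)) with hJ
  have hJ0 : 0 ≤ J := by
    have h1 : 0 ≤ ∫ x, S x := integral_nonneg hS0
    have h2 : 0 ≤ ∫ q : EuclideanSpace ℝ (Fin 3), (1 + ‖q‖) ^ (-4 : ℝ) :=
      integral_nonneg (fun q => by positivity)
    positivity
  set A := C * (2 * m ^ (1 - α) * (1 + 1 / m) ^ (α - 2)) with hA
  have hA0 : 0 < A := by positivity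
  set ν₁ := A * (J + 1) with hν₁
  have hν₁0 : 0 < ν₁ := by positivity
  have main : ∀ p, collFreq m β σ p ≤ ν₁ * energy m p ^ (-((α - 2) / 2)) := by
    intro p
    have hX := energy_ge m hm p
    have hX0 : 0 < energy m p := by linarith
    set P := energy m p * energy m p ^ (-((α - 2) / 2)) with hP
    have hP0 : 0 < P := by positivity
    have hSp : Integrable (fun q => S (q - p)) := hS.comp_sub_right p
    have hFi : Integrable (fun q => A * P * (D1 * S (q - p) + D2 * (1 + ‖q‖) ^ (-4 : ℝ))) :=
      ((hSp.const_mul _).add (hT.const_mul _)).const_mul _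
    have hle : ∫ q : EuclideanSpace ℝ (Fin 3),
        (Real.exp (-β * energy m q) / energy m q) * relMom m p q *
        Real.sqrt ((relMom m p q) ^ 2 + 4 * m ^ 2) * totalXsec σ (relMom m p q)
        ≤ ∫ q, A * P * (D1 * S (q - p) + D2 * (1 + ‖q‖) ^ (-4 : ℝ)) := by
      apply integral_mono_of_nonneg
      · refine Filter.Eventually.of_forall fun q => ?_
        have h1 := totalXsec_nonneg σ hσ (relMom m p q)
        have h2 : 0 < energy m q := by linarith [energy_ge m hm q]
        have h3 : 0 ≤ relMom m p q := Real.sqrt_nonneg _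
        simp only [Pi.zero_apply]
        positivity
      · exact hFi
      · have hne : ∀ᵐ q : EuclideanSpace ℝ (Fin 3), q ≠ p := by
          simp [ae_iff]
        filter_upwards [hne] with q hq
        have hr : 0 < ‖q - p‖ := norm_pos_iff.2 (sub_ne_zero.2 hq)
        have hY := energy_ge m hm q
        have hY0 : 0 < energy m q := by linarith
        obtain ⟨f1, f2⟩ := relMom_facts m hm p q
        have hg0 : 0 ≤ relMom m p q := Real.sqrt_nonneg _
        have hg : 0 < relMom m p q := by
          rcases hg0.lt_or_eq with h | h
          · exact h
          · rw [← h] at f1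
            have : 0 < m ^ 2 * ‖q - p‖ ^ 2 := by positivity
            simp at f1; linarith
        have hpt := pointwise_real m β α hm hα3 _ _ _ _ _ hX hY hr hg0 f1
          (energy_le_add m hm p q) f2
        have hCg := hCb _ hg
        have hw1q := hw1 _ hY
        have hw2q := hw2 q
        have hSq := hS0 (q - p)
        calc _ ≤ (Real.exp (-β * energy m q) / energy m q) * relMom m p q *
              Real.sqrt ((relMom m p q) ^ 2 + 4 * m ^ 2) * (C * relMom m p q ^ (-α)) := by gcongr
          _ = C * ((Real.exp (-β * energy m q) / energy m q) * relMom m p q *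
              Real.sqrt ((relMom m p q) ^ 2 + 4 * m ^ 2) * relMom m p q ^ (-α)) := by ring
          _ ≤ C * (2 * m ^ (1 - α) * (1 + 1 / m) ^ (α - 2) * P *
              (Real.exp (-β * energy m q) * energy m q ^ k) * (S (q - p) + 1)) := by
              gcongr
          _ = A * P * ((Real.exp (-β * energy m q) * energy m q ^ k) * S (q - p) +
              (Real.exp (-β * energy m q) * energy m q ^ k)) := by rw [hA]; ring
          _ ≤ _ := by gcongr
    have hval : ∫ q, A * P * (D1 * S (q - p) + D2 * (1 + ‖q‖) ^ (-4 : ℝ)) = A * P * J := by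
      rw [integral_const_mul, integral_add (hSp.const_mul _) (hT.const_mul _),
        integral_const_mul, integral_const_mul, integral_sub_right_eq_self S p]
    rw [hval] at hle
    unfold collFreq
    calc _ ≤ (energy m p)⁻¹ * (A * P * J) := by gcongr
      _ = A * J * energy m p ^ (-((α - 2) / 2)) := by rw [hP]; field_simp
      _ ≤ _ := by rw [hν₁]; gcongr; linarith
  have main2 : ∀ p, collFreq m β σ p ≤
      ν₁ * m ^ (-((α - 2) / 2)) * (energy m p / m) ^ (-((α - 2) / 2)) := by
    intro p
    have hX := energy_ge m hm p
    refine (main p).trans_eq ?_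
    have hX0 : 0 < energy m p := by linarith
    have e : m ^ (-((α - 2) / 2)) * (energy m p / m) ^ (-((α - 2) / 2))
        = energy m p ^ (-((α - 2) / 2)) := by
      rw [← Real.mul_rpow hm.le (by positivity), mul_div_cancel₀ _ hm.ne']
    rw [mul_assoc ν₁, e]
  refine ⟨ν₁ * m ^ (-((α - 2) / 2)), by positivity, main2, fun p => (main2 p).trans ?_⟩
  have hX := energy_ge m hm p
  refine mul_le_of_le_one_right (by positivity) ?_
  exact Real.rpow_le_one_of_one_le_of_nonpos ((one_le_div hm).2 hX) (by linarith)
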